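/- With the cancellation data, ι ∗ π is homotopic to the identity morphism I_N via H: ι ∗ π − I_N = (μ ⊗ id_N) ∘ (id_A ⊗ H) ∘ δ + (μ ⊗ id_N) ∘ (id_A ⊗ δ) ∘ H + (d ⊗ ε_N) ∘ H, where ι ∗ π = (μ ⊗ id_N) ∘ (id_A ⊗ ι) ∘ π. -/

import Mathlib

open TensorProduct

noncomputable section

/-- The sign `(-1)^j` for an integer `j`. -/
def zsign (j : ℤ) : ℤ := (((-1 : ℤˣ) ^ j : ℤˣ) : ℤ)

/-- The collapse map `A ⊗ (A ⊗ M) → A ⊗ M`, i.e. `(μ ⊗ id)` after reassociation. -/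
def mu2 (R A M : Type*) [CommRing R] [Ring A] [Algebra R A]
    [AddCommGroup M] [Module R M] :
    A ⊗[R] (A ⊗[R] M) →ₗ[R] A ⊗[R] M :=
  (TensorProduct.map (LinearMap.mul' R A) (LinearMap.id : M →ₗ[R] M)) ∘ₗ
    (TensorProduct.assoc R A A M).symm.toLinearMap

/-- The composition `f ∗ g = (μ ⊗ id) ∘ (id_A ⊗ f) ∘ g` of type-D-style maps. -/
def dstar {R A : Type*} [CommRing R] [Ring A] [Algebra R A]
    {M₁ M₂ M₃ : Type*} [AddCommGroup M₁] [Module R M₁]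
    [AddCommGroup M₂] [Module R M₂] [AddCommGroup M₃] [Module R M₃]
    (f : M₂ →ₗ[R] A ⊗[R] M₃) (g : M₁ →ₗ[R] A ⊗[R] M₂) :
    M₁ →ₗ[R] A ⊗[R] M₃ :=
  mu2 R A M₃ ∘ₗ LinearMap.lTensor A f ∘ₗ g


/-- A sum over `Fin n` splits into its first two terms and the sum over the indices `≥ 2`. -/
theorem Fin.sum_eq_add_add_sum_subtype {M : Type*} [AddCommMonoid M] {n : ℕ} (hn : 2 ≤ n)
    (f : Fin n → M) :
    ∑ j, f j = f ⟨0, Nat.zero_lt_two.trans_le hn⟩ + f ⟨1, Nat.one_lt_two.trans_le hn⟩ +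
      ∑ j : {j : Fin n // 2 ≤ (j : ℕ)}, f j.1 := by
  obtain ⟨k, rfl⟩ := Nat.exists_eq_add_of_le' hn
  have h : ∑ j : {j : Fin (k + 2) // 2 ≤ (j : ℕ)}, f j.1 = ∑ i : Fin k, f i.succ.succ := by
    refine (Fintype.sum_bijective
      (fun i : Fin k ↦ (⟨i.succ.succ, by simp⟩ : {j : Fin (k + 2) // 2 ≤ (j : ℕ)}))
      ⟨fun i j hij ↦ by simpa using hij, ?_⟩ _ _ fun _ ↦ rfl).symm
    rintro ⟨⟨j, hj⟩, hj2 : 2 ≤ j⟩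
    exact ⟨⟨j - 2, by omega⟩, Subtype.ext (Fin.ext (by simp; omega))⟩
  rw [h, Fin.sum_univ_succ, Fin.sum_univ_succ, ← add_assoc]
  rfl

theorem mu2_tmul_tmul {R A M : Type*} [CommRing R] [Ring A] [Algebra R A]
    [AddCommGroup M] [Module R M] (a b : A) (x : M) :
    mu2 R A M (a ⊗ₜ[R] (b ⊗ₜ[R] x)) = (a * b) ⊗ₜ[R] x := by
  simp [mu2]

theorem mu2_one_tmul {R A M : Type*} [CommRing R] [Ring A] [Algebra R A]
    [AddCommGroup M] [Module R M] (y : A ⊗[R] M) :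
    mu2 R A M ((1 : A) ⊗ₜ[R] y) = y := by
  induction y with
  | zero => simp
  | tmul b x => simp [mu2_tmul_tmul]
  | add y z hy hz => rw [TensorProduct.tmul_add, map_add, hy, hz]

theorem dstar_apply {R A : Type*} [CommRing R] [Ring A] [Algebra R A]
    {M₁ M₂ M₃ : Type*} [AddCommGroup M₁] [Module R M₁]
    [AddCommGroup M₂] [Module R M₂] [AddCommGroup M₃] [Module R M₃]
    (f : M₂ →ₗ[R] A ⊗[R] M₃) (g : M₁ →ₗ[R] A ⊗[R] M₂) (x : M₁) :
    dstar f g x = mu2 R A M₃ (LinearMap.lTensor A f (g x)) :=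
  rfl

/-- with the cancellation data, `ι ∗ π` is homotopic to the identity
morphism `I_N` via `H`:
`ι ∗ π − I_N = (μ ⊗ id_N) ∘ (id_A ⊗ H) ∘ δ + (μ ⊗ id_N) ∘ (id_A ⊗ δ) ∘ H + (d ⊗ ε_N) ∘ H`.
(Paper indices `1, 2` correspond to the Lean indices `⟨0,_⟩, ⟨1,_⟩` of `Fin n`,
and `i ≥ 3` to `2 ≤ (i : ℕ)`.) -/
theorem iota_star_pi_homotopic_identity
    {R A : Type*} [CommRing R] [Ring A] [Algebra R A]
    (𝒜 : ℤ → Submodule R A) [GradedAlgebra 𝒜]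
    (d : A →ₗ[R] A) (hd1 : d 1 = 0)
    (hLeib : ∀ (j : ℤ) (α β : A), β ∈ 𝒜 j →
      d (α * β) = zsign j • (d α * β) + α * d β)
    (n : ℕ) (hn : 2 ≤ n) (m : Fin n → ℤ) (a : Fin n → Fin n → A)
    (ha : ∀ i j, a i j ∈ 𝒜 (m i - m j + 1))
    (hstruct : ∀ i k, zsign (m k) • d (a i k) + ∑ j, a i j * a j k = 0)
    (haii : ∀ i, a i i = 0)
    (ha12 : a ⟨0, by omega⟩ ⟨1, by omega⟩ = 1)
    (hm : m ⟨1, by omega⟩ = m ⟨0, by omega⟩ + 1)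
    (δ : (Fin n → R) →ₗ[R] A ⊗[R] (Fin n → R))
    (hδ : ∀ i, δ (Pi.basisFun R (Fin n) i) =
      ∑ j, a i j ⊗ₜ[R] (Pi.basisFun R (Fin n) j : Fin n → R))
    (ε : (Fin n → R) →ₗ[R] (Fin n → R))
    (hε : ∀ i, ε (Pi.basisFun R (Fin n) i) =
      zsign (m i) • (Pi.basisFun R (Fin n) i : Fin n → R))
    (ι : ({j : Fin n // 2 ≤ (j : ℕ)} → R) →ₗ[R] A ⊗[R] (Fin n → R))
    (hι : ∀ i : {j : Fin n // 2 ≤ (j : ℕ)},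
      ι (Pi.basisFun R {j : Fin n // 2 ≤ (j : ℕ)} i) =
        (1 : A) ⊗ₜ[R] (Pi.basisFun R (Fin n) i.1 : Fin n → R)
          - a i.1 ⟨1, by omega⟩ ⊗ₜ[R]
              (Pi.basisFun R (Fin n) ⟨0, by omega⟩ : Fin n → R))
    (π : (Fin n → R) →ₗ[R] A ⊗[R] ({j : Fin n // 2 ≤ (j : ℕ)} → R))
    (hπ1 : π (Pi.basisFun R (Fin n) ⟨0, by omega⟩) = 0)
    (hπ2 : π (Pi.basisFun R (Fin n) ⟨1, by omega⟩) =
      - ∑ j : {j : Fin n // 2 ≤ (j : ℕ)},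
          a ⟨0, by omega⟩ j.1 ⊗ₜ[R]
            (Pi.basisFun R {j : Fin n // 2 ≤ (j : ℕ)} j
              : {j : Fin n // 2 ≤ (j : ℕ)} → R))
    (hπ3 : ∀ (i : Fin n) (hi : 2 ≤ (i : ℕ)),
      π (Pi.basisFun R (Fin n) i) =
        (1 : A) ⊗ₜ[R] (Pi.basisFun R {j : Fin n // 2 ≤ (j : ℕ)} ⟨i, hi⟩
          : {j : Fin n // 2 ≤ (j : ℕ)} → R))
    (H : (Fin n → R) →ₗ[R] A ⊗[R] (Fin n → R))
    (hH2 : H (Pi.basisFun R (Fin n) ⟨1, by omega⟩) =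
      -((1 : A) ⊗ₜ[R] (Pi.basisFun R (Fin n) ⟨0, by omega⟩ : Fin n → R)))
    (hH0 : ∀ i : Fin n, i ≠ ⟨1, by omega⟩ → H (Pi.basisFun R (Fin n) i) = 0) :
    dstar ι π - TensorProduct.mk R A (Fin n → R) 1 =
      dstar H δ + dstar δ H + (TensorProduct.map d ε) ∘ₗ H := by
  have hHδ (i : Fin n) : dstar H δ (Pi.basisFun R (Fin n) i) =
      -(a i ⟨1, by omega⟩ ⊗ₜ[R] Pi.basisFun R (Fin n) ⟨0, by omega⟩) := by
    rw [dstar_apply, hδ, map_sum, map_sum, Finset.sum_eq_single ⟨1, by omega⟩]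
    · rw [LinearMap.lTensor_tmul, hH2, TensorProduct.tmul_neg, map_neg, mu2_tmul_tmul, mul_one]
    · intro j _ hj
      rw [LinearMap.lTensor_tmul, hH0 j hj, TensorProduct.tmul_zero, map_zero]
    · simp
  refine (Pi.basisFun R (Fin n)).ext fun i ↦ ?_
  rw [LinearMap.sub_apply, LinearMap.add_apply, LinearMap.add_apply, LinearMap.comp_apply, hHδ,
    dstar_apply, dstar_apply, TensorProduct.mk_apply]
  by_cases hi2 : 2 ≤ (i : ℕ)
  · have hi : i ≠ ⟨1, by omega⟩ := fun h ↦ by simp [h] at hi2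
    rw [hπ3 i hi2, hH0 i hi, LinearMap.lTensor_tmul, mu2_one_tmul, hι]
    simp only [map_zero]
    abel
  obtain hi | hi : i = ⟨0, by omega⟩ ∨ i = ⟨1, by omega⟩ := by
    simp only [Fin.ext_iff]
    omega
  · rw [hi, hπ1, hH0 _ (by simp), ha12]
    simp only [map_zero]
    abel
  · have hsum : ∑ j : {j : Fin n // 2 ≤ (j : ℕ)},
        (a ⟨0, by omega⟩ j.1 * a j.1 ⟨1, by omega⟩) ⊗ₜ[R]
          (Pi.basisFun R (Fin n) ⟨0, by omega⟩ : Fin n → R) = 0 := by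
      have h := hstruct ⟨0, by omega⟩ ⟨1, by omega⟩
      rw [Fin.sum_eq_add_add_sum_subtype hn, ha12, hd1, haii, haii] at h
      simp only [smul_zero, zero_mul, mul_zero, zero_add] at h
      simpa only [TensorProduct.sum_tmul, TensorProduct.zero_tmul] using
        congrArg (· ⊗ₜ[R] (Pi.basisFun R (Fin n) ⟨0, by omega⟩ : Fin n → R)) h
    rw [hi, hπ2, hH2, haii]
    simp only [map_neg, map_sum, LinearMap.lTensor_tmul, TensorProduct.map_tmul, mu2_one_tmul, hι,
      hδ, hd1, TensorProduct.zero_tmul, TensorProduct.tmul_sub, map_sub, mu2_tmul_tmul, mul_one,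
      Finset.sum_sub_distrib]
    rw [hsum, Fin.sum_eq_add_add_sum_subtype hn, ha12, haii, TensorProduct.zero_tmul]
    abel

end
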